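/- arXiv:1701.01564 — 3 statements merged into one kernel-verified Lean document; each statement's English description precedes it below -/
import Mathlib

section
/- Let H' be an (r−1)-uniform intersecting hypergraph with r ≥ 3 such that τ(H') = r − 1 and every vertex has degree at least 2. Then every vertex v of H' satisfies 2 ≤ qd(v) ≤ r − 1, where qd(v) is the quasidegree of v. -/
open Finset

variable {V : Type*} [DecidableEq V] [Fintype V]

/-- A set `D` dominates: every vertex outside `D` lies in an edge meeting `D`. -/
def isDominating (E : Finset (Finset V)) (D : Finset V) : Prop :=
  ∀ v : V, v ∉ D → ∃ e ∈ E, v ∈ e ∧ ∃ u ∈ e, u ∈ D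

/-- Domination number. -/
noncomputable def domNum (E : Finset (Finset V)) : ℕ :=
  sInf {n | ∃ D : Finset V, isDominating E D ∧ D.card = n}

/-- A transversal meets every edge. -/
def isTransversal (E : Finset (Finset V)) (T : Finset V) : Prop :=
  ∀ e ∈ E, ∃ v ∈ e, v ∈ T

/-- Transversal number. -/
noncomputable def tauNum (E : Finset (Finset V)) : ℕ :=
  sInf {n | ∃ T : Finset V, isTransversal E T ∧ T.card = n}

/-- A matching: a set of pairwise disjoint edges of `E`. -/
def isMatching (E M : Finset (Finset V)) : Prop :=
  M ⊆ E ∧ ∀ e ∈ M, ∀ f ∈ M, e ≠ f → e ∩ f = ∅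

/-- Matching number. -/
noncomputable def matchNum (E : Finset (Finset V)) : ℕ :=
  sSup {n | ∃ M : Finset (Finset V), isMatching E M ∧ M.card = n}

/-- Intersecting: any two edges meet. -/
def Intersecting (E : Finset (Finset V)) : Prop :=
  ∀ e ∈ E, ∀ f ∈ E, (e ∩ f).Nonempty

/-- Linear: any two distinct edges meet in at most one vertex. -/
def Linear (E : Finset (Finset V)) : Prop :=
  ∀ e ∈ E, ∀ f ∈ E, e ≠ f → (e ∩ f).card ≤ 1

/-- No isolated vertices: every vertex lies in some edge. -/
def NoIsolated (E : Finset (Finset V)) : Prop :=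
  ∀ v : V, ∃ e ∈ E, v ∈ e

/-- Degree of a vertex. -/
def degree (E : Finset (Finset V)) (v : V) : ℕ :=
  (E.filter (fun e => v ∈ e)).card

/-- Maximum degree. -/
def maxDegree (E : Finset (Finset V)) : ℕ :=
  Finset.univ.sup (fun v => degree E v)

/-- Quasidegree: max number of edges containing `v` pairwise intersecting exactly in `{v}`. -/
noncomputable def quasidegree (E : Finset (Finset V)) (v : V) : ℕ :=
  sSup {n | ∃ S : Finset (Finset V), S ⊆ E ∧ S.card = n ∧ (∀ e ∈ S, v ∈ e) ∧
    ∀ e ∈ S, ∀ f ∈ S, e ≠ f → e ∩ f = {v}}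

theorem exists_edge_missing (E : Finset (Finset V)) (T : Finset V) (h : T.card < tauNum E) :
    ∃ e ∈ E, ∀ x ∈ e, x ∉ T := by
  by_contra! hc
  have : tauNum E ≤ T.card := Nat.sInf_le ⟨T, hc, rfl⟩
  omega

theorem stmt_7 (E : Finset (Finset V)) (r : ℕ) (hr : 3 ≤ r)
    (hunif : ∀ e ∈ E, e.card = r - 1)
    (hint : Intersecting E)
    (htau : tauNum E = r - 1)
    (hdeg : ∀ v : V, 2 ≤ degree E v) :
    ∀ v : V, 2 ≤ quasidegree E v ∧ quasidegree E v ≤ r - 1 := by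
  intro v
  constructor
  · have hne : (E.filter (fun e => v ∈ e)).Nonempty := by
      have := hdeg v
      unfold degree at this
      exact Finset.card_pos.mp (by omega)
    obtain ⟨e, he⟩ := hne
    rw [Finset.mem_filter] at he
    obtain ⟨heE, hve⟩ := he
    have hce := hunif e heE
    have hcard : (e.erase v).card = r - 1 - 1 := by rw [Finset.card_erase_of_mem hve, hce]
    obtain ⟨f, hfE, hf⟩ := exists_edge_missing E (e.erase v) (by omega)
    have hef : ∀ x, x ∈ e → x ∈ f → x = v := by
      intro x hxe hxf
      by_contra hx
      exact hf x hxf (Finset.mem_erase.mpr ⟨hx, hxe⟩)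
    have hvf : v ∈ f := by
      obtain ⟨x, hx⟩ := hint e heE f hfE
      rw [Finset.mem_inter] at hx
      have := hef x hx.1 hx.2
      exact this ▸ hx.2
    have hinter : e ∩ f = {v} := by
      ext x
      rw [Finset.mem_inter, Finset.mem_singleton]
      exact ⟨fun h => hef x h.1 h.2, fun h => by rw [h]; exact ⟨hve, hvf⟩⟩
    have hneq : e ≠ f := by
      intro h
      have h2 : e = {v} := by rw [← hinter, ← h, Finset.inter_self]
      rw [h2, Finset.card_singleton] at hce
      omega
    apply le_csSup
    · refine ⟨E.card, ?_⟩
      rintro n ⟨S, hS, rfl, -⟩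
      exact Finset.card_le_card hS
    · refine ⟨{e, f}, ?_, Finset.card_pair hneq, ?_, ?_⟩
      · intro x hx
        simp only [Finset.mem_insert, Finset.mem_singleton] at hx
        rcases hx with rfl | rfl <;> assumption
      · intro x hx
        simp only [Finset.mem_insert, Finset.mem_singleton] at hx
        rcases hx with rfl | rfl <;> assumption
      · intro x hx y hy hxy
        simp only [Finset.mem_insert, Finset.mem_singleton] at hx hy
        rcases hx with rfl | rfl <;> rcases hy with rfl | rfl
        · exact absurd rfl hxy
        · exact hinter
        · rw [Finset.inter_comm]; exact hinter
        · exact absurd rfl hxy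
  · obtain ⟨f, hfE, hf⟩ := exists_edge_missing E {v} (by rw [Finset.card_singleton]; omega)
    apply csSup_le
    · exact ⟨0, ∅, by simp⟩
    · rintro n ⟨S, hS, rfl, hvS, hSS⟩
      have hex : ∀ e : Finset V, ∃ x : V, e ∈ S → x ∈ e ∧ x ∈ f := by
        intro e
        by_cases he : e ∈ S
        · obtain ⟨x, hx⟩ := hint e (hS he) f hfE
          exact ⟨x, fun _ => Finset.mem_inter.mp hx⟩
        · exact ⟨v, fun h => absurd h he⟩
      choose g hg using hex
      rw [← hunif f hfE]
      apply Finset.card_le_card_of_injOn g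
      · intro e he
        exact (hg e he).2
      · intro a ha b hb hab
        by_contra hne
        have h1 := hg a ha
        have h2 := hg b hb
        have h3 : g a ∈ a ∩ b := Finset.mem_inter.mpr ⟨h1.1, hab ▸ h2.1⟩
        rw [hSS a ha b hb hne] at h3
        exact hf _ h1.2 h3
end

section
/- Let H' be a linear intersecting (r−1)-uniform hypergraph with r ≥ 3, τ(H') = r − 1, maximum degree at most r − 1, minimum degree at least 2, and with at most one degree-2 vertex per edge. Then 3(r−2) ≤ |E(H')| ≤ (r−1)² − (r−1) + 1. -/
open Finset

variable {V : Type*} [DecidableEq V] [Fintype V]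

set_option linter.unusedSectionVars false

namespace LinSp

section
variable {P Λ : Type*} [DecidableEq P] [Fintype P] [DecidableEq Λ] [Fintype Λ]

/-- A linear space: two points lie on a unique line, each point on `k` lines,
and no fewer than `k` lines cover everything. -/
structure Sp (L : Λ → Finset P) (k : ℕ) : Prop where
  kpos : 1 ≤ k
  pair : ∀ p q, p ≠ q → ∃ l, p ∈ L l ∧ q ∈ L l
  uniq : ∀ p q l l', p ≠ q → p ∈ L l → q ∈ L l → p ∈ L l' → q ∈ L l' → l = l'
  deg : ∀ p, (univ.filter (fun l => p ∈ L l)).card = k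
  cov : ∀ C : Finset Λ, (∀ p, ∃ l ∈ C, p ∈ L l) → k ≤ C.card

variable {L : Λ → Finset P} {k : ℕ}

theorem Sp.line (h : Sp L k) (p : P) : ∃ l, p ∈ L l := by
  have h1 := h.deg p
  have h2 := h.kpos
  have : (univ.filter (fun l => p ∈ L l)).Nonempty := by
    rw [← Finset.card_pos]; omega
  obtain ⟨l, hl⟩ := this
  exact ⟨l, by simpa using hl⟩

theorem Sp.cover_pairs (h : Sp L k) : ∀ (n : ℕ) (S : Finset P), S.card = n →
    ∃ C : Finset Λ, (∀ p ∈ S, ∃ l ∈ C, p ∈ L l) ∧ C.card ≤ (n + 1) / 2 := by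
  intro n
  induction n using Nat.strong_induction_on with
  | _ n ih =>
    intro S hS
    rcases Nat.lt_or_ge n 2 with hn | hn
    · rcases Nat.eq_zero_or_pos n with h0 | h0
      · subst h0
        rw [Finset.card_eq_zero] at hS
        subst hS
        exact ⟨∅, by simp, by simp⟩
      · have : S.card = 1 := by omega
        obtain ⟨a, rfl⟩ := Finset.card_eq_one.mp this
        obtain ⟨l, hl⟩ := h.line a
        refine ⟨{l}, by simpa using hl, ?_⟩
        simp; omega
    · obtain ⟨a, ha, b, hb, hab⟩ := Finset.one_lt_card.mp (show 1 < S.card by omega)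
      obtain ⟨l, hl1, hl2⟩ := h.pair a b hab
      have hb' : b ∈ S.erase a := Finset.mem_erase.mpr ⟨hab.symm, hb⟩
      have hc : ((S.erase a).erase b).card = n - 2 := by
        rw [Finset.card_erase_of_mem hb', Finset.card_erase_of_mem ha]; omega
      obtain ⟨C, hC, hCc⟩ := ih (n - 2) (by omega) _ hc
      refine ⟨insert l C, ?_, ?_⟩
      · intro p hp
        by_cases h1 : p = a
        · exact ⟨l, by simp, h1 ▸ hl1⟩
        by_cases h2 : p = b
        · exact ⟨l, by simp, h2 ▸ hl2⟩
        obtain ⟨l', hl', hp'⟩ := hC p (by simp [h1, h2, hp])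
        exact ⟨l', by simp [hl'], hp'⟩
      · have := Finset.card_insert_le l C
        omega

/-- Counting along the lines through a point. -/
theorem Sp.sum_lines (h : Sp L k) (p : P) (S : Finset P) :
    ∑ l ∈ univ.filter (fun l => p ∈ L l), ((L l ∩ S).erase p).card = (S.erase p).card := by
  rw [← Finset.card_biUnion]
  · congr 1
    ext q
    simp only [Finset.mem_biUnion, Finset.mem_filter, Finset.mem_univ, true_and,
      Finset.mem_erase, Finset.mem_inter]
    constructor
    · rintro ⟨l, hl, h1, h2, h3⟩
      exact ⟨h1, h3⟩
    · rintro ⟨h1, h2⟩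
      obtain ⟨l, h3, h4⟩ := h.pair p q (Ne.symm h1)
      exact ⟨l, h3, h1, h4, h2⟩
  · intro l hl l' hl' hne
    refine Finset.disjoint_left.mpr ?_
    intro q hq hq'
    simp only [Finset.coe_filter, Set.mem_ofPred_eq, Finset.mem_univ, true_and,
      Finset.mem_erase, Finset.mem_inter] at hl hl' hq hq'
    exact hne (h.uniq p q l l' (Ne.symm hq.1) hl hq.2.1 hl' hq'.2.1)

theorem stage1 (L : Λ → Finset P) : ∃ (C : Finset Λ) (W : Finset P),
    (∀ p, p ∉ W → ∃ l ∈ C, p ∈ L l) ∧ 4 * C.card + W.card ≤ Fintype.card P ∧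
    ∀ l, (L l ∩ W).card ≤ 3 := by
  have key : ∀ (n : ℕ) (C : Finset Λ) (W : Finset P), W.card = n →
      (∀ p, p ∉ W → ∃ l ∈ C, p ∈ L l) → 4 * C.card + W.card ≤ Fintype.card P →
      ∃ (C : Finset Λ) (W : Finset P),
      (∀ p, p ∉ W → ∃ l ∈ C, p ∈ L l) ∧ 4 * C.card + W.card ≤ Fintype.card P ∧
      ∀ l, (L l ∩ W).card ≤ 3 := by
    intro n
    induction n using Nat.strong_induction_on with
    | _ n ih =>
      intro C W hW h1 h2
      by_cases h3 : ∀ l, (L l ∩ W).card ≤ 3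
      · exact ⟨C, W, h1, h2, h3⟩
      · push Not at h3
        obtain ⟨l, hl⟩ := h3
        have hc : (W \ L l).card + (L l ∩ W).card = W.card := by
          rw [Finset.inter_comm]; exact Finset.card_sdiff_add_card_inter W (L l)
        have hi := Finset.card_insert_le l C
        refine ih (W \ L l).card (by omega) (insert l C) (W \ L l) rfl ?_ (by omega)
        intro p hp
        by_cases hpl : p ∈ L l
        · exact ⟨l, by simp, hpl⟩
        · obtain ⟨l', h4, h5⟩ := h1 p (fun hh => hp (by simp [hh, hpl]))
          exact ⟨l', by simp [h4], h5⟩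
  refine key _ ∅ univ rfl (by simp) (by simp)

/-- packings of triples inside `W` -/
def Pack (L : Λ → Finset P) (W : Finset P) (Q : Finset Λ) : Prop :=
  (∀ l ∈ Q, (L l ∩ W).card = 3) ∧
    ∀ l ∈ Q, ∀ l' ∈ Q, l ≠ l' → Disjoint (L l ∩ W) (L l' ∩ W)

theorem exists_max_pack (L : Λ → Finset P) (W : Finset P) :
    ∃ Q, Pack L W Q ∧ ∀ Q', Pack L W Q' → Q'.card ≤ Q.card := by
  classical
  have hne : (univ.filter (fun Q : Finset Λ => Pack L W Q)).Nonempty :=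
    ⟨∅, Finset.mem_filter.mpr ⟨Finset.mem_univ _, by simp [Pack]⟩⟩
  obtain ⟨Q, hQ, hm⟩ := Finset.exists_max_image _ Finset.card hne
  exact ⟨Q, by simpa using hQ, fun Q' h' => hm Q' (by simpa using h')⟩

/-- leftover -/
def Lft (L : Λ → Finset P) (W : Finset P) (Q : Finset Λ) : Finset P :=
  W \ Q.biUnion (fun l => L l ∩ W)

theorem mem_Lft {W : Finset P} {Q : Finset Λ} {p : P} :
    p ∈ Lft L W Q ↔ p ∈ W ∧ ∀ l ∈ Q, p ∉ L l := by
  simp only [Lft, Finset.mem_sdiff, Finset.mem_biUnion, Finset.mem_inter]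
  constructor
  · rintro ⟨h1, h2⟩
    exact ⟨h1, fun l hl hp => h2 ⟨l, hl, hp, h1⟩⟩
  · rintro ⟨h1, h2⟩
    exact ⟨h1, fun ⟨l, hl, hp, _⟩ => h2 l hl hp⟩

/-- The setting after both greedy stages. -/
structure Conf (L : Λ → Finset P) (k : ℕ) (W : Finset P) (Q : Finset Λ) : Prop where
  sp : Sp L k
  three : ∀ l, (L l ∩ W).card ≤ 3
  pack : Pack L W Q
  mx : ∀ Q', Pack L W Q' → Q'.card ≤ Q.card

variable {W : Finset P} {Q : Finset Λ}

theorem Conf.card_bi (h : Conf L k W Q) : (Q.biUnion (fun l => L l ∩ W)).card = 3 * Q.card := by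
  rw [Finset.card_biUnion (fun l hl l' hl' hne => h.pack.2 l hl l' hl' hne),
    Finset.sum_congr rfl h.pack.1]
  simp [mul_comm]

theorem Conf.cardW (h : Conf L k W Q) : W.card = 3 * Q.card + (Lft L W Q).card := by
  have h1 : Q.biUnion (fun l => L l ∩ W) ⊆ W := by
    intro p hp
    simp only [Finset.mem_biUnion, Finset.mem_inter] at hp
    obtain ⟨_, _, _, h⟩ := hp
    exact h
  have := Finset.card_sdiff_add_card_eq_card h1
  rw [h.card_bi] at this
  rw [Lft]; omega

theorem Lft_sub : Lft L W Q ⊆ W := Finset.sdiff_subset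

theorem Conf.two (h : Conf L k W Q) (l : Λ) : (L l ∩ Lft L W Q).card ≤ 2 := by
  by_contra hc
  push Not at hc
  have hs : L l ∩ Lft L W Q ⊆ L l ∩ W := Finset.inter_subset_inter_left Lft_sub
  have he := Finset.eq_of_subset_of_card_le hs (by have := h.three l; omega)
  have hlQ : l ∉ Q := by
    intro hl
    have : L l ∩ Lft L W Q = ∅ := by
      ext p
      simp only [Finset.mem_inter, mem_Lft, Finset.notMem_empty, iff_false]
      rintro ⟨h1, _, h2⟩
      exact h2 l hl h1
    rw [this] at hc; simp at hc
  have hd : ∀ l' ∈ Q, Disjoint (L l ∩ W) (L l' ∩ W) := by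
    intro l' hl'
    rw [← he, Finset.disjoint_left]
    intro p hp hp'
    simp only [Finset.mem_inter, mem_Lft] at hp hp'
    exact hp.2.2 l' hl' hp'.1
  have hp : Pack L W (insert l Q) := by
    constructor
    · intro l' hl'
      rcases Finset.mem_insert.mp hl' with rfl | hl'
      · have := h.three l'; rw [← he] at this ⊢; omega
      · exact h.pack.1 l' hl'
    · intro a ha b hb hab
      rw [Finset.mem_insert] at ha hb
      rcases ha with rfl | ha <;> rcases hb with rfl | hb
      · exact absurd rfl hab
      · exact hd b hb
      · exact (hd a ha).symm
      · exact h.pack.2 a ha b hb hab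
  have := h.mx _ hp
  rw [Finset.card_insert_of_notMem hlQ] at this
  omega

/-- No exchange of one triple for two. -/
theorem Conf.exch (h : Conf L k W Q) {t l m : Λ} (ht : t ∈ Q)
    (hl3 : (L l ∩ W).card = 3) (hm3 : (L m ∩ W).card = 3)
    (hl : L l ∩ W ⊆ Lft L W Q ∪ L t) (hm : L m ∩ W ⊆ Lft L W Q ∪ L t)
    (hd : Disjoint (L l ∩ W) (L m ∩ W)) : False := by
  have aux : ∀ l, L l ∩ W ⊆ Lft L W Q ∪ L t → ∀ s ∈ Q.erase t, Disjoint (L l ∩ W) (L s ∩ W) := by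
    intro l hl s hs
    rw [Finset.disjoint_left]
    intro p hp hp'
    have h1 := hl hp
    rw [Finset.mem_union, mem_Lft] at h1
    rcases h1 with h1 | h1
    · exact h1.2 s (Finset.mem_of_mem_erase hs) (Finset.mem_inter.mp hp').1
    · exact Finset.disjoint_left.mp (h.pack.2 s (Finset.mem_of_mem_erase hs) t ht
        (Finset.ne_of_mem_erase hs)) hp' (Finset.mem_inter.mpr ⟨h1, (Finset.mem_inter.mp hp).2⟩)
  have nself : ∀ l, (L l ∩ W).card = 3 → ¬ Disjoint (L l ∩ W) (L l ∩ W) := by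
    intro l hl hd
    rw [disjoint_self] at hd
    rw [hd] at hl; simp at hl
  have hmQ : m ∉ Q.erase t := fun hh => nself m hm3 (aux m hm m hh)
  have hlQ : l ∉ insert m (Q.erase t) := by
    intro hh
    rcases Finset.mem_insert.mp hh with rfl | hh
    · exact nself _ hl3 hd
    · exact nself l hl3 (aux l hl l hh)
  have hp : Pack L W (insert l (insert m (Q.erase t))) := by
    constructor
    · intro a ha
      simp only [Finset.mem_insert] at ha
      rcases ha with rfl | rfl | ha
      · exact hl3
      · exact hm3
      · exact h.pack.1 a (Finset.mem_of_mem_erase ha)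
    · intro a ha b hb hab
      rw [Finset.mem_insert, Finset.mem_insert] at ha hb
      rcases ha with rfl | rfl | ha <;> rcases hb with rfl | rfl | hb
      · exact absurd rfl hab
      · exact hd
      · exact aux _ hl b hb
      · exact hd.symm
      · exact absurd rfl hab
      · exact aux _ hm b hb
      · exact (aux _ hl a ha).symm
      · exact (aux _ hm a ha).symm
      · exact h.pack.2 a (Finset.mem_of_mem_erase ha) b (Finset.mem_of_mem_erase hb) hab
  have := h.mx _ hp
  rw [Finset.card_insert_of_notMem hlQ, Finset.card_insert_of_notMem hmQ,
    Finset.card_erase_of_mem ht] at this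
  have : 0 < Q.card := Finset.card_pos.mpr ⟨t, ht⟩
  omega

/-- points of the leftover matched by `x` -/
noncomputable def N (L : Λ → Finset P) (W : Finset P) (Q : Finset Λ) (x : P) : Finset P := by
  classical
  exact (Lft L W Q).filter (fun p => ∃ l, x ∈ L l ∧ p ∈ L l ∧ ∃ q ∈ Lft L W Q, q ≠ p ∧ q ∈ L l)

theorem mem_N {x p : P} : p ∈ N L W Q x ↔ p ∈ Lft L W Q ∧
    ∃ l, x ∈ L l ∧ p ∈ L l ∧ ∃ q ∈ Lft L W Q, q ≠ p ∧ q ∈ L l := by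
  simp [N]

theorem N_sub {x : P} : N L W Q x ⊆ Lft L W Q := fun _ hp => (mem_N.mp hp).1

/-- A line through a covered `x` and two leftover points is exactly that triple. -/
theorem Conf.triple (h : Conf L k W Q) {x p q : P} {l : Λ} (hx : x ∈ W) (hxU : x ∉ Lft L W Q)
    (hp : p ∈ Lft L W Q) (hq : q ∈ Lft L W Q) (hpq : q ≠ p) (hxl : x ∈ L l) (hpl : p ∈ L l)
    (hql : q ∈ L l) : L l ∩ W = {x, p, q} ∧ (L l ∩ W).card = 3 := by
  have hxp : x ≠ p := fun e => hxU (e ▸ hp)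
  have hxq : x ≠ q := fun e => hxU (e ▸ hq)
  have hc : ({x, p, q} : Finset P).card = 3 := by
    rw [Finset.card_eq_three]; exact ⟨x, p, q, hxp, hxq, hpq.symm, rfl⟩
  have hs : ({x, p, q} : Finset P) ⊆ L l ∩ W := by
    intro a ha
    simp only [Finset.mem_insert, Finset.mem_singleton] at ha
    rcases ha with rfl | rfl | rfl
    · simp [hxl, hx]
    · simp [hpl, Lft_sub hp]
    · simp [hql, Lft_sub hq]
  have he := Finset.eq_of_subset_of_card_le hs (by have := h.three l; omega)
  exact ⟨he.symm, by rw [← he, hc]⟩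

theorem Conf.N_exch (h : Conf L k W Q) {t : Λ} (ht : t ∈ Q) {x y : P} (hx : x ∈ L t ∩ W)
    (hy : y ∈ L t ∩ W) (hxy : x ≠ y) {q : P} (hq : q ∈ N L W Q y) :
    (N L W Q x).card ≤ 4 ∧ ((N L W Q x).card = 4 → q ∈ N L W Q x) := by
  obtain ⟨hqU, m, hym, hqm, q', hq'U, hq'q, hq'm⟩ := mem_N.mp hq
  rw [Finset.mem_inter] at hx hy
  have hxU : x ∉ Lft L W Q := fun hh => (mem_Lft.mp hh).2 t ht hx.1
  have hyU : y ∉ Lft L W Q := fun hh => (mem_Lft.mp hh).2 t ht hy.1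
  obtain ⟨hm, hm3⟩ := h.triple hy.2 hyU hqU hq'U hq'q hym hqm hq'm
  have hxq : x ≠ q := fun e => hxU (e ▸ hqU)
  have hxq' : x ≠ q' := fun e => hxU (e ▸ hq'U)
  obtain ⟨a, ha1, ha2⟩ := h.sp.pair x q hxq
  obtain ⟨b, hb1, hb2⟩ := h.sp.pair x q' hxq'
  have hsub : N L W Q x ⊆ (L a ∩ Lft L W Q) ∪ (L b ∩ Lft L W Q) := by
    intro p hp
    obtain ⟨hpU, l, hxl, hpl, p', hp'U, hp'p, hp'l⟩ := mem_N.mp hp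
    obtain ⟨hl, hl3⟩ := h.triple hx.2 hxU hpU hp'U hp'p hxl hpl hp'l
    by_contra hcon
    have hql : q ∉ L l := by
      intro hh
      have := h.sp.uniq x q a l hxq ha1 ha2 hxl hh
      subst this
      exact hcon (by simp [hpl, hpU])
    have hq'l : q' ∉ L l := by
      intro hh
      have := h.sp.uniq x q' b l hxq' hb1 hb2 hxl hh
      subst this
      exact hcon (by simp [hpl, hpU])
    refine h.exch ht hl3 hm3 ?_ ?_ ?_
    · rw [hl]; intro c hc
      simp only [Finset.mem_insert, Finset.mem_singleton] at hc
      rcases hc with rfl | rfl | rfl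
      · simp [hx.1]
      · simp [hpU]
      · simp [hp'U]
    · rw [hm]; intro c hc
      simp only [Finset.mem_insert, Finset.mem_singleton] at hc
      rcases hc with rfl | rfl | rfl
      · simp [hy.1]
      · simp [hqU]
      · simp [hq'U]
    · rw [Finset.disjoint_right, hm]
      intro c hc hc'
      have hcl := (Finset.mem_inter.mp hc').1
      rw [hl] at hc'
      simp only [Finset.mem_insert, Finset.mem_singleton] at hc hc'
      rcases hc with rfl | rfl | rfl
      · rcases hc' with h1 | h1 | h1
        · exact hxy h1.symm
        · exact hyU (h1 ▸ hpU)
        · exact hyU (h1 ▸ hp'U)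
      · exact hql hcl
      · exact hq'l hcl
  have h1 := Finset.card_le_card hsub
  have h2 := Finset.card_union_le (L a ∩ Lft L W Q) (L b ∩ Lft L W Q)
  have h3 := h.two a
  have h4 := h.two b
  refine ⟨by omega, fun h5 => ?_⟩
  have := Finset.eq_of_subset_of_card_le hsub (by omega)
  rw [this]
  simp [ha2, hqU]

/-- support of a triple -/
noncomputable def supp (L : Λ → Finset P) (W : Finset P) (Q : Finset Λ) (t : Λ) : Finset P :=
  (L t ∩ W).biUnion (N L W Q)

/-- weight of a triple -/
noncomputable def wt (L : Λ → Finset P) (W : Finset P) (Q : Finset Λ) (t : Λ) : ℕ :=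
  ∑ x ∈ L t ∩ W, (N L W Q x).card

/-- contribution of a triple at a point -/
noncomputable def dd (L : Λ → Finset P) (W : Finset P) (Q : Finset Λ) (t : Λ) (p : P) : ℕ :=
  ((L t ∩ W).filter (fun x => p ∈ N L W Q x)).card

theorem sum_dd (t : Λ) : ∑ p ∈ Lft L W Q, dd L W Q t p = wt L W Q t := by
  unfold dd wt
  simp_rw [Finset.card_filter]
  rw [Finset.sum_comm]
  refine Finset.sum_congr rfl fun x _ => ?_
  rw [← Finset.card_filter]
  congr 1
  ext p
  simp only [Finset.mem_filter]
  exact ⟨fun h => h.2, fun h => ⟨N_sub h, h⟩⟩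

theorem Conf.dd_le (h : Conf L k W Q) (t : Λ) (p : P) :
    dd L W Q t p ≤ 3 * (if p ∈ supp L W Q t then 1 else 0) := by
  split_ifs with hp
  · have := h.three t
    have h2 := Finset.card_filter_le (L t ∩ W) (fun x => p ∈ N L W Q x)
    unfold dd; omega
  · have : (L t ∩ W).filter (fun x => p ∈ N L W Q x) = ∅ := by
      rw [Finset.filter_eq_empty_iff]
      intro x hx hh
      exact hp (Finset.mem_biUnion.mpr ⟨x, hx, hh⟩)
    unfold dd; rw [this]; simp

theorem Conf.wt_le (h : Conf L k W Q) {t : Λ} (ht : t ∈ Q) :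
    (wt L W Q t ≤ (Lft L W Q).card ∨ wt L W Q t ≤ 12) ∧
    ((Lft L W Q).card < wt L W Q t → 10 ≤ wt L W Q t → (supp L W Q t).card ≤ 4) := by
  obtain ⟨x, y, z, hxy, hxz, hyz, he⟩ := Finset.card_eq_three.mp (h.pack.1 t ht)
  have hx : x ∈ L t ∩ W := by rw [he]; simp
  have hy : y ∈ L t ∩ W := by rw [he]; simp
  have hz : z ∈ L t ∩ W := by rw [he]; simp
  have hw : wt L W Q t = (N L W Q x).card + (N L W Q y).card + (N L W Q z).card := by
    unfold wt
    rw [he, Finset.sum_insert (by simp [hxy, hxz]), Finset.sum_pair hyz, add_assoc]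
  have hu : ∀ a, (N L W Q a).card ≤ (Lft L W Q).card := fun a => Finset.card_le_card N_sub
  have four : ∀ a ∈ L t ∩ W, ∀ b ∈ L t ∩ W, a ≠ b → 0 < (N L W Q b).card →
      (N L W Q a).card ≤ 4 := by
    intro a ha b hb hab hpos
    obtain ⟨q, hq⟩ := Finset.card_pos.mp hpos
    exact (h.N_exch ht ha hb hab hq).1
  have sub : ∀ a ∈ L t ∩ W, (N L W Q a).card = 4 → (supp L W Q t).card ≤ 4 := by
    intro a ha h4
    rw [← h4]
    apply Finset.card_le_card
    intro q hq
    obtain ⟨b, hb, hqb⟩ := Finset.mem_biUnion.mp hq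
    by_cases hab : a = b
    · rw [hab]; exact hqb
    · exact (h.N_exch ht ha hb hab hqb).2 h4
  have f1 := four x hx y hy hxy
  have f2 := four x hx z hz hxz
  have f3 := four y hy x hx hxy.symm
  have f4 := four y hy z hz hyz
  have f5 := four z hz x hx hxz.symm
  have f6 := four z hz y hy hyz.symm
  have ux := hu x
  have uy := hu y
  have uz := hu z
  have s1 := sub x hx
  have s2 := sub y hy
  have s3 := sub z hz
  constructor
  · omega
  · intro h1 h2
    by_cases c1 : (N L W Q x).card = 4
    · exact s1 c1
    by_cases c2 : (N L W Q y).card = 4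
    · exact s2 c2
    by_cases c3 : (N L W Q z).card = 4
    · exact s3 c3
    omega

theorem Conf.count (h : Conf L k W Q) {p : P} (hp : p ∈ Lft L W Q) :
    3 * Q.card + 2 * (Lft L W Q).card ≤ 2 * k + ∑ t ∈ Q, dd L W Q t p + 2 := by
  set U := Lft L W Q with hU
  have hpW : p ∈ W := Lft_sub hp
  have e1 := h.sp.sum_lines p W
  have e2 := h.sp.sum_lines p U
  rw [Finset.card_erase_of_mem hpW] at e1
  rw [Finset.card_erase_of_mem hp] at e2
  have hcW := h.cardW
  rw [← hU] at hcW
  have hUpos : 0 < U.card := Finset.card_pos.mpr ⟨p, hp⟩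
  have hdeg := h.sp.deg p
  set F := univ.filter (fun l => p ∈ L l) with hF
  let c : Λ → Finset P := fun l => ((L l ∩ W) \ U).filter (fun x => p ∈ N L W Q x)
  have hline : ∀ l ∈ F, ((L l ∩ W).erase p).card + ((L l ∩ U).erase p).card ≤ 2 + (c l).card := by
    intro l hl
    have hpl : p ∈ L l := by simpa [hF] using hl
    have hpi : p ∈ L l ∩ W := by simp [hpl, hpW]
    have hpi' : p ∈ L l ∩ U := by simp [hpl, hp]
    have t3 := h.three l
    have t2 := h.two l
    rw [← hU] at t2
    rw [Finset.card_erase_of_mem hpi, Finset.card_erase_of_mem hpi']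
    have pos1 : 0 < (L l ∩ U).card := Finset.card_pos.mpr ⟨p, hpi'⟩
    by_cases h1 : (L l ∩ U).card = 1
    · omega
    · have h2 : 1 < (L l ∩ U).card := by omega
      obtain ⟨q, hq, hqp⟩ := Finset.exists_mem_ne h2 p
      have hc : c l = (L l ∩ W) \ U := by
        apply Finset.filter_true_of_mem
        intro x hx
        simp only [Finset.mem_sdiff, Finset.mem_inter] at hx
        rw [mem_N]
        exact ⟨hp, l, hx.1.1, hpl, q, (Finset.mem_inter.mp hq).2, hqp, (Finset.mem_inter.mp hq).1⟩
      have hsd : (L l ∩ W) \ U = (L l ∩ W) \ (L l ∩ U) := by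
        ext a; simp only [Finset.mem_sdiff, Finset.mem_inter]; tauto
      have hsub : L l ∩ U ⊆ L l ∩ W := Finset.inter_subset_inter_left Lft_sub
      have := Finset.card_sdiff_add_card_eq_card hsub
      rw [hc, hsd]
      omega
  have hsum := Finset.sum_le_sum hline
  rw [Finset.sum_add_distrib, Finset.sum_add_distrib, e1, e2, Finset.sum_const, hdeg,
    smul_eq_mul] at hsum
  have hc1 : ∑ l ∈ F, (c l).card = (F.biUnion c).card := by
    rw [Finset.card_biUnion]
    intro l hl l' hl' hne
    refine Finset.disjoint_left.mpr ?_
    intro x hx hx'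
    simp only [c, hF, Finset.coe_filter, Set.mem_ofPred_eq, Finset.mem_filter, Finset.mem_sdiff,
      Finset.mem_inter, Finset.mem_univ, true_and] at hl hl' hx hx'
    have hxp : x ≠ p := fun e => hx.1.2 (e ▸ hp)
    exact hne (h.sp.uniq x p l l' hxp hx.1.1.1 hl hx'.1.1.1 hl')
  have hc2 : (F.biUnion c).card ≤ ∑ t ∈ Q, dd L W Q t p := by
    unfold dd
    refine le_trans (Finset.card_le_card ?_) Finset.card_biUnion_le
    intro x hx
    obtain ⟨l, hl, hxc⟩ := Finset.mem_biUnion.mp hx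
    simp only [c, Finset.mem_filter, Finset.mem_sdiff, Finset.mem_inter] at hxc
    have : ∃ t ∈ Q, x ∈ L t := by
      by_contra hcon
      push Not at hcon
      exact hxc.1.2 (mem_Lft.mpr ⟨hxc.1.1.2, hcon⟩)
    obtain ⟨t, ht, hxt⟩ := this
    refine Finset.mem_biUnion.mpr ⟨t, ht, ?_⟩
    simp only [Finset.mem_filter, Finset.mem_inter]
    exact ⟨⟨hxt, hxc.1.1.2⟩, hxc.2⟩
  omega

theorem Conf.le2k (h : Conf L k W Q) {p : P} (hp : p ∈ W) : W.card ≤ 2 * k + 1 := by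
  have e1 := h.sp.sum_lines p W
  rw [Finset.card_erase_of_mem hp] at e1
  have : ∀ l ∈ univ.filter (fun l => p ∈ L l), ((L l ∩ W).erase p).card ≤ 2 := by
    intro l hl
    have hpl : p ∈ L l := by simpa using hl
    rw [Finset.card_erase_of_mem (by simp [hpl, hp])]
    have := h.three l
    omega
  have := Finset.sum_le_sum this
  rw [e1, Finset.sum_const, h.sp.deg, smul_eq_mul] at this
  omega

/-- If `W` is locally a Steiner system and is not everything, its size is divisible by 3. -/
theorem Conf.div (h : Conf L k W Q) (hw : W.card = 2 * k + 1) {o : P} (ho : o ∉ W) :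
    3 ∣ W.card := by
  have hall : ∀ p ∈ W, ∀ l, p ∈ L l → (L l ∩ W).card = 3 := by
    intro p hp l hpl
    have e1 := h.sp.sum_lines p W
    rw [Finset.card_erase_of_mem hp] at e1
    have h2 : ∀ l ∈ univ.filter (fun l => p ∈ L l), ((L l ∩ W).erase p).card ≤ 2 := by
      intro l hl
      have hpl : p ∈ L l := by simpa using hl
      rw [Finset.card_erase_of_mem (by simp [hpl, hp])]
      have := h.three l
      omega
    by_contra hne
    have h3 : ((L l ∩ W).erase p).card < 2 := by
      rw [Finset.card_erase_of_mem (by simp [hpl, hp])]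
      have := h.three l
      omega
    have := Finset.sum_lt_sum h2 ⟨l, by simpa using hpl, h3⟩
    rw [e1, Finset.sum_const, h.sp.deg, smul_eq_mul] at this
    omega
  have e := h.sp.sum_lines o W
  rw [Finset.erase_eq_of_notMem ho] at e
  rw [← e]
  apply Finset.dvd_sum
  intro l _
  rw [Finset.erase_eq_of_notMem (by simp [ho])]
  rcases Finset.eq_empty_or_nonempty (L l ∩ W) with h0 | ⟨p, hp⟩
  · rw [h0]; simp
  · rw [Finset.mem_inter] at hp
    rw [hall p hp.2 l hp.1]

theorem Conf.sum_supp (h : Conf L k W Q) (j : ℕ)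
    (ha : ∀ p ∈ Lft L W Q, 3 * j < ∑ t ∈ Q, dd L W Q t p)
    (hs : ∀ t ∈ Q, (supp L W Q t).card ≤ 4) :
    (j + 1) * (Lft L W Q).card ≤ 4 * Q.card := by
  have h1 : ∀ p ∈ Lft L W Q, j + 1 ≤ ∑ t ∈ Q, (if p ∈ supp L W Q t then 1 else 0) := by
    intro p hp
    have := ha p hp
    have h2 : ∑ t ∈ Q, dd L W Q t p ≤ ∑ t ∈ Q, 3 * (if p ∈ supp L W Q t then 1 else 0) :=
      Finset.sum_le_sum fun t _ => h.dd_le t p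
    rw [← Finset.mul_sum] at h2
    omega
  have h2 := Finset.sum_le_sum h1
  rw [Finset.sum_const, smul_eq_mul, Finset.sum_comm] at h2
  have h3 : ∑ t ∈ Q, ∑ p ∈ Lft L W Q, (if p ∈ supp L W Q t then 1 else 0) ≤ ∑ t ∈ Q, 4 := by
    refine Finset.sum_le_sum fun t ht => ?_
    rw [← Finset.card_filter]
    refine le_trans (Finset.card_le_card ?_) (hs t ht)
    intro p hp
    exact (Finset.mem_filter.mp hp).2
  rw [Finset.sum_const, smul_eq_mul] at h3
  rw [mul_comm]
  omega

theorem Conf.total (h : Conf L k W Q) {b : ℕ}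
    (ha : ∀ p ∈ Lft L W Q, b ≤ ∑ t ∈ Q, dd L W Q t p) :
    (Lft L W Q).card * b ≤ ∑ t ∈ Q, wt L W Q t := by
  have := Finset.sum_le_sum ha
  rw [Finset.sum_const, smul_eq_mul, Finset.sum_comm] at this
  simpa only [sum_dd] using this

theorem main (h : Sp L k) : 3 * (k - 1) ≤ Fintype.card P := by
  obtain ⟨C, W, hC, hcard, h3⟩ := stage1 L
  obtain ⟨Q, hQ, hmx⟩ := exists_max_pack L W
  have hc : Conf L k W Q := ⟨h, h3, hQ, hmx⟩
  by_contra hcon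
  push Not at hcon
  have hW := hc.cardW
  obtain ⟨D, hD, hDc⟩ := h.cover_pairs _ (Lft L W Q) rfl
  have hk : k ≤ C.card + Q.card + ((Lft L W Q).card + 1) / 2 := by
    have h1 := h.cov (C ∪ Q ∪ D) (by
      intro p
      by_cases hp : p ∈ W
      · by_cases hpU : p ∈ Lft L W Q
        · obtain ⟨l, hl, hpl⟩ := hD p hpU
          exact ⟨l, by simp [hl], hpl⟩
        · have : ∃ t ∈ Q, p ∈ L t := by
            by_contra hcon
            push Not at hcon
            exact hpU (mem_Lft.mpr ⟨hp, hcon⟩)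
          obtain ⟨l, hl, hpl⟩ := this
          exact ⟨l, by simp [hl], hpl⟩
      · obtain ⟨l, hl, hpl⟩ := hC p hp
        exact ⟨l, by simp [hl], hpl⟩)
    have h2 := Finset.card_union_le (C ∪ Q) D
    have h4 := Finset.card_union_le C Q
    omega
  have hcnt := fun p (hp : p ∈ Lft L W Q) => hc.count hp
  have hwt := fun t (ht : t ∈ Q) => hc.wt_le ht
  have hupos : 0 < (Lft L W Q).card := by
    by_contra h0
    omega
  obtain ⟨p0, hp0⟩ := Finset.card_pos.mp hupos
  have h2k := hc.le2k (Lft_sub hp0)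
  have hdiv := fun e o => hc.div (o := o) e
  have htot := fun b => hc.total (b := b)
  have hss := hc.sum_supp
  have hout : Fintype.card P = W.card ∨ ∃ o, o ∉ W := by
    by_cases hall : ∀ o, o ∈ W
    · left
      have : W = univ := by ext; simp [hall]
      rw [this]; simp
    · right; push Not at hall; exact hall
  obtain ⟨u, hu⟩ : ∃ u, u = (Lft L W Q).card := ⟨_, rfl⟩
  obtain ⟨s, hs⟩ : ∃ s, s = Q.card := ⟨_, rfl⟩
  rw [← hu, ← hs] at hW hk
  rw [← hu] at hupos
  have hkle : k ≤ s + u - 2 := by omega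
  have ha : ∀ p ∈ Lft L W Q, s + 2 ≤ ∑ t ∈ Q, dd L W Q t p := by
    intro p hp
    have := hcnt p hp
    omega
  have hsu : s + 3 ≤ u := by omega
  have htot2 := htot _ ha
  rw [← hu] at htot2
  -- large leftover
  rcases Nat.lt_or_ge u 12 with hu12 | hu12
  swap
  · have : ∑ t ∈ Q, wt L W Q t ≤ ∑ t ∈ Q, u := by
      refine Finset.sum_le_sum fun t ht => ?_
      have := (hwt t ht).1
      omega
    rw [Finset.sum_const, smul_eq_mul, ← hs] at this
    nlinarith
  have hwt12 : ∀ t ∈ Q, wt L W Q t ≤ 12 := by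
    intro t ht
    have := (hwt t ht).1
    omega
  have hle12 : ∑ t ∈ Q, wt L W Q t ≤ s * 12 := by
    have := Finset.sum_le_sum hwt12
    rw [Finset.sum_const, smul_eq_mul, ← hs] at this
    exact this
  -- all triples except one weigh at most 12 each
  have hone : ∀ t ∈ Q, ∑ t ∈ Q, wt L W Q t ≤ wt L W Q t + (s - 1) * 12 := by
    intro t ht
    rw [← Finset.add_sum_erase _ _ ht]
    have := Finset.sum_le_sum (fun t' (ht' : t' ∈ Q.erase t) => hwt12 t' (Finset.mem_of_mem_erase ht'))
    rw [Finset.sum_const, smul_eq_mul, Finset.card_erase_of_mem ht, ← hs] at this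
    omega
  have hcases : (u = 5 ∧ s = 2) ∨ (u = 7 ∧ s = 3) ∨ (u = 7 ∧ s = 4) ∨ (u = 9 ∧ s = 6) := by
    have h5 := le_trans htot2 hle12
    have hev : 2 ∣ u → u ≤ s + 2 := by
      intro he
      exfalso
      have ha' : ∀ p ∈ Lft L W Q, s + 6 ≤ ∑ t ∈ Q, dd L W Q t p := by
        intro p hp
        have := hcnt p hp
        omega
      have h6 := le_trans (htot _ ha') hle12
      rw [← hu] at h6
      clear htot hss hdiv hcnt
      interval_cases u <;> omega
    clear htot hss hdiv hcnt
    interval_cases u <;> omega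
  rcases hcases with ⟨rfl, rfl⟩ | ⟨rfl, rfl⟩ | ⟨rfl, rfl⟩ | ⟨rfl, rfl⟩
  · -- (5,2)
    have : ∃ t ∈ Q, 10 ≤ wt L W Q t := by
      by_contra hno
      push Not at hno
      have := Finset.sum_le_sum (fun t ht => Nat.le_of_lt_succ (hno t ht))
      rw [Finset.sum_const, smul_eq_mul, ← hs] at this
      omega
    obtain ⟨t, ht, h10⟩ := this
    have hsp := (hwt t ht).2 (by omega) h10
    obtain ⟨p, hp, hpn⟩ := Finset.exists_mem_notMem_of_card_lt_card
      (show (supp L W Q t).card < (Lft L W Q).card by omega)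
    have h1 := ha p hp
    rw [← Finset.add_sum_erase _ _ ht] at h1
    have h2 := hc.dd_le t p
    rw [if_neg hpn] at h2
    have h4 : ∑ t ∈ Q.erase t, dd L W Q t p ≤ ∑ t ∈ Q.erase t, 3 := by
      refine Finset.sum_le_sum fun t' _ => ?_
      have := hc.dd_le t' p
      split_ifs at this <;> omega
    rw [Finset.sum_const, smul_eq_mul, Finset.card_erase_of_mem ht, ← hs] at h4
    omega
  · have := hss 1 (fun p hp => by have := ha p hp; omega) (fun t ht => by
      have h1 := hone t ht
      exact (hwt t ht).2 (by omega) (by omega))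
    omega
  · rcases hout with ho | ⟨o, ho⟩
    · omega
    · have := hdiv (by omega) o ho
      omega
  · have := hss 2 (fun p hp => by have := ha p hp; omega) (fun t ht => by
      have h1 := hone t ht
      exact (hwt t ht).2 (by omega) (by omega))
    omega

end

end LinSp

theorem stmt_10 (E : Finset (Finset V)) (r : ℕ) (hr : 3 ≤ r)
    (hlin : Linear E) (hint : Intersecting E)
    (hunif : ∀ e ∈ E, e.card = r - 1)
    (htau : tauNum E = r - 1)
    (hmax : maxDegree E ≤ r - 1)
    (hdeg : ∀ v : V, 2 ≤ degree E v)
    (hdeg2 : ∀ e ∈ E, (e.filter (fun v => degree E v = 2)).card ≤ 1) :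
    3 * (r - 2) ≤ E.card ∧ E.card ≤ (r - 1) ^ 2 - (r - 1) + 1 := by
  constructor
  · have hsp : LinSp.Sp (P := {e // e ∈ E}) (Λ := V)
        (fun v => univ.filter (fun e => v ∈ e.1)) (r - 1) := by
      refine ⟨by omega, ?_, ?_, ?_, ?_⟩
      · intro p q _
        obtain ⟨v, hv⟩ := hint p.1 p.2 q.1 q.2
        rw [Finset.mem_inter] at hv
        exact ⟨v, by simpa using hv⟩
      · intro p q l l' hpq h1 h2 h3 h4
        simp only [Finset.mem_filter, Finset.mem_univ, true_and] at h1 h2 h3 h4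
        have hc := hlin p.1 p.2 q.1 q.2 (fun e => hpq (Subtype.ext e))
        exact Finset.card_le_one.mp hc l (by simp [h1, h2]) l' (by simp [h3, h4])
      · intro p
        rw [← hunif p.1 p.2]
        congr 1
        ext v
        simp
      · intro C hC
        rw [← htau]
        refine Nat.sInf_le ⟨C, ?_, rfl⟩
        intro e he
        obtain ⟨l, hl, h1⟩ := hC ⟨e, he⟩
        exact ⟨l, by simpa using h1, hl⟩
    have := LinSp.main hsp
    rw [Fintype.card_coe] at this
    have h2 : r - 2 = r - 1 - 1 := by omega
    rw [h2]; exact this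
  · rcases Finset.eq_empty_or_nonempty E with rfl | ⟨e, he⟩
    · simp
    · have hsub : E.erase e ⊆ e.biUnion (fun v => (E.filter (fun f => v ∈ f)).erase e) := by
        intro f hf
        rw [Finset.mem_erase] at hf
        obtain ⟨v, hv⟩ := hint e he f hf.2
        rw [Finset.mem_inter] at hv
        simp only [Finset.mem_biUnion, Finset.mem_erase, Finset.mem_filter]
        exact ⟨v, hv.1, hf.1, hf.2, hv.2⟩
      have h1 := le_trans (Finset.card_le_card hsub) Finset.card_biUnion_le
      have h2 : ∑ v ∈ e, ((E.filter (fun f => v ∈ f)).erase e).card ≤ ∑ v ∈ e, (r - 2) := by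
        refine Finset.sum_le_sum fun v hv => ?_
        rw [Finset.card_erase_of_mem (by simp [he, hv])]
        have h3 : degree E v ≤ maxDegree E :=
          Finset.le_sup (f := fun v => degree E v) (Finset.mem_univ v)
        unfold degree at h3
        omega
      rw [Finset.sum_const, hunif e he, smul_eq_mul] at h2
      rw [Finset.card_erase_of_mem he] at h1
      obtain ⟨k, rfl⟩ : ∃ k, r = k + 2 := ⟨r - 2, by omega⟩
      have h4 : (k + 2 - 1) ^ 2 - (k + 2 - 1) = (k + 1) * k := by
        have : (k + 2 - 1) = k + 1 := by omega
        rw [this]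
        have : (k + 1) ^ 2 = (k + 1) * k + (k + 1) := by ring
        omega
      rw [h4]
      have h5 : (k + 2 - 1) * (k + 2 - 2) = (k + 1) * k := by congr 1
      rw [h5] at h2
      omega
end

section
/- If H is a linear intersecting hypergraph of rank 4 without isolated vertices and γ(H) = 3, then H is isomorphic to one of the four hypergraphs F₁, F₁⁻, F₂, F₃ constructed from the Fano plane. -/
open Finset

variable {V : Type*} [DecidableEq V] [Fintype V]

/-- `E` is a Fano plane on point set `S`. -/
def isFano (S : Finset V) (E : Finset (Finset V)) : Prop :=
  S.card = 7 ∧ E.card = 7 ∧ (∀ e ∈ E, e ⊆ S ∧ e.card = 3) ∧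
  (∀ u ∈ S, ∀ v ∈ S, u ≠ v → ∃! e, e ∈ E ∧ u ∈ e ∧ v ∈ e)

/-- `E₁` is (a copy of) `F₁`: the Fano plane with a distinct private new vertex added
to each edge, covering the whole vertex set. -/
def isF1 (E₁ : Finset (Finset V)) : Prop :=
  ∃ (S : Finset V) (E : Finset (Finset V)) (p : Finset V → V),
    isFano S E ∧ (∀ e ∈ E, p e ∉ S) ∧ Set.InjOn p (E : Set (Finset V)) ∧
    (∀ w : V, w ∈ S ∨ ∃ e ∈ E, p e = w) ∧
    E₁ = E.image (fun e => insert (p e) e)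

/-- `E₁` is (a copy of) `F₁⁻`: the Fano plane minus an edge, with a distinct private
new vertex added to each remaining edge, covering the whole vertex set. -/
def isF1minus (E₁ : Finset (Finset V)) : Prop :=
  ∃ (S : Finset V) (E : Finset (Finset V)) (e₀ : Finset V) (p : Finset V → V),
    isFano S E ∧ e₀ ∈ E ∧ (∀ e ∈ E.erase e₀, p e ∉ S) ∧
    Set.InjOn p ((E.erase e₀ : Finset (Finset V)) : Set (Finset V)) ∧
    (∀ w : V, w ∈ S ∨ ∃ e ∈ E.erase e₀, p e = w) ∧
    E₁ = (E.erase e₀).image (fun e => insert (p e) e)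

/-- `E₂` is (a copy of) `F₂`: `F₁` with the private degree-1 vertex removed from
exactly one edge (shrinking it back to a 3-edge). -/
def isF2 (E₂ : Finset (Finset V)) : Prop :=
  ∃ (S : Finset V) (E : Finset (Finset V)) (e₀ : Finset V) (p : Finset V → V),
    isFano S E ∧ e₀ ∈ E ∧ (∀ e ∈ E.erase e₀, p e ∉ S) ∧
    Set.InjOn p ((E.erase e₀ : Finset (Finset V)) : Set (Finset V)) ∧
    (∀ w : V, w ∈ S ∨ ∃ e ∈ E.erase e₀, p e = w) ∧
    E₂ = insert e₀ ((E.erase e₀).image (fun e => insert (p e) e))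

/-- `E₃` is (a copy of) `F₃`: `F₁⁻` together with one new 4-edge `{x₁,x₂,x₃,x₄}`
whose vertices lie in four distinct edges of `F₁⁻`, with `x₁,x₂` of degree 2 and
`x₃,x₄` of degree 1 in `F₁⁻`. -/
def isF3 (E₃ : Finset (Finset V)) : Prop :=
  ∃ (E₁ : Finset (Finset V)) (x₁ x₂ x₃ x₄ : V) (e₁ e₂ e₃ e₄ : Finset V),
    isF1minus E₁ ∧
    ({x₁, x₂, x₃, x₄} : Finset V).card = 4 ∧
    e₁ ∈ E₁ ∧ e₂ ∈ E₁ ∧ e₃ ∈ E₁ ∧ e₄ ∈ E₁ ∧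
    e₁ ≠ e₂ ∧ e₁ ≠ e₃ ∧ e₁ ≠ e₄ ∧ e₂ ≠ e₃ ∧ e₂ ≠ e₄ ∧ e₃ ≠ e₄ ∧
    x₁ ∈ e₁ ∧ x₂ ∈ e₂ ∧ x₃ ∈ e₃ ∧ x₄ ∈ e₄ ∧
    degree E₁ x₁ = 2 ∧ degree E₁ x₂ = 2 ∧ degree E₁ x₃ = 1 ∧ degree E₁ x₄ = 1 ∧
    E₃ = insert ({x₁, x₂, x₃, x₄} : Finset V) E₁

/-- The working hypotheses: linear, intersecting, rank at most four, no isolated vertices,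
and no two vertices dominate. -/
structure Good (E : Finset (Finset V)) : Prop where
  lin : ∀ e ∈ E, ∀ f ∈ E, ∀ u v : V, u ∈ e → v ∈ e → u ∈ f → v ∈ f → u ≠ v → e = f
  int : ∀ e ∈ E, ∀ f ∈ E, ∃ v, v ∈ e ∧ v ∈ f
  rank : ∀ e ∈ E, e.card ≤ 4
  ni : ∀ v : V, ∃ e ∈ E, v ∈ e
  K : ∀ u v : V, ∃ w, ∀ e ∈ E, w ∈ e → u ∉ e ∧ v ∉ e

theorem degree_pos' {E : Finset (Finset V)} {e : Finset V} {v : V} (he : e ∈ E) (hv : v ∈ e) :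
    1 ≤ degree E v :=
  Finset.card_pos.2 ⟨e, by simp [he, hv]⟩

theorem Good.deg_pos {E : Finset (Finset V)} (h : Good E) (v : V) : 1 ≤ degree E v := by
  obtain ⟨e, he, hv⟩ := h.ni v
  exact degree_pos' he hv

theorem deg_one_unique {E : Finset (Finset V)} {e f : Finset V} {v : V} (hd : degree E v = 1)
    (he : e ∈ E) (hf : f ∈ E) (hve : v ∈ e) (hvf : v ∈ f) : e = f :=
  Finset.card_le_one.1 (le_of_eq hd) e (by simp [he, hve]) f (by simp [hf, hvf])

theorem exists_other {E : Finset (Finset V)} {e : Finset V} {v : V} (hd : 2 ≤ degree E v) :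
    ∃ f ∈ E, v ∈ f ∧ f ≠ e := by
  obtain ⟨f, hf, hne⟩ := Finset.exists_mem_ne (s := E.filter (fun e => v ∈ e)) hd e
  simp at hf
  exact ⟨f, hf.1, hf.2, hne⟩

theorem degree_erase (E : Finset (Finset V)) {f : Finset V} (hf : f ∈ E) (v : V) :
    degree E v = degree (E.erase f) v + (if v ∈ f then 1 else 0) := by
  unfold degree
  conv_lhs => rw [← Finset.insert_erase hf]
  rw [Finset.filter_insert]
  split_ifs with h
  · rw [Finset.card_insert_of_notMem (by simp)]
  · simp

theorem Good.deg_le {E : Finset (Finset V)} (h : Good E) (u : V) : degree E u ≤ 3 := by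
  obtain ⟨w, hw⟩ := h.K u u
  obtain ⟨e, he, hwe⟩ := h.ni w
  have hue := (hw e he hwe).1
  have : Nonempty V := ⟨u⟩
  choose! p hp using fun f (hf : f ∈ E) => h.int e he f hf
  have : degree E u ≤ (e.erase w).card := by
    apply Finset.card_le_card_of_injOn p
    · intro f hf
      simp at hf
      have := hp f hf.1
      simp only [Finset.coe_erase, Set.mem_sdiff, Finset.mem_coe, Set.mem_singleton_iff]
      refine ⟨this.1, fun hh => ?_⟩
      rw [hh] at this
      exact (hw f hf.1 this.2).1 hf.2
    · intro f hf g hg hfg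
      simp at hf hg
      have h1 := hp f hf.1
      have h2 := hp g hg.1
      rw [← hfg] at h2
      exact h.lin f hf.1 g hg.1 _ _ hf.2 h1.2 hg.2 h2.2 (fun hh => hue (hh ▸ h1.1))
  rw [Finset.card_erase_of_mem hwe] at this
  have := h.rank e he
  omega

theorem sum_deg (E : Finset (Finset V)) (e : Finset V) :
    ∑ v ∈ e, degree E v = ∑ f ∈ E, (e.filter (fun v => v ∈ f)).card := by
  exact Finset.sum_card_bipartiteAbove_eq_sum_card_bipartiteBelow (fun (v : V) f => v ∈ f)

theorem Good.sum_edge {E : Finset (Finset V)} (h : Good E) {e : Finset V} (he : e ∈ E) :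
    ∑ v ∈ e, degree E v + 1 = E.card + e.card := by
  rw [sum_deg, ← Finset.add_sum_erase _ _ he]
  have h1 : ∀ f ∈ E.erase e, (e.filter (fun v => v ∈ f)).card = 1 := by
    intro f hf
    simp at hf
    obtain ⟨v, hv⟩ := h.int e he f hf.2
    rw [Finset.card_eq_one]
    refine ⟨v, ?_⟩
    ext x
    simp only [Finset.mem_filter, Finset.mem_singleton]
    constructor
    · rintro ⟨hx1, hx2⟩
      by_contra hne
      exact hf.1 (h.lin f hf.2 e he x v hx2 hv.2 hx1 hv.1 hne)
    · rintro rfl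
      exact hv
  rw [Finset.sum_congr rfl h1]
  have : e.filter (fun v => v ∈ e) = e := by simp
  have hc := Finset.card_erase_add_one he
  simp only [Finset.sum_const, smul_eq_mul, mul_one]
  rw [this]
  omega

/-- number of vertices of degree `k` on `e` -/
def nd (E : Finset (Finset V)) (k : ℕ) (e : Finset V) : ℕ :=
  (e.filter (fun v => degree E v = k)).card

theorem Good.counts {E : Finset (Finset V)} (h : Good E) {e : Finset V} (he : e ∈ E) :
    nd E 1 e + nd E 2 e + nd E 3 e = e.card ∧
    nd E 1 e + 2 * nd E 2 e + 3 * nd E 3 e + 1 = E.card + e.card ∧ e.card ≤ 4 := by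
  have hr : ∀ v, degree E v = 1 ∨ degree E v = 2 ∨ degree E v = 3 := by
    intro v
    have := h.deg_pos v
    have := h.deg_le v
    omega
  refine ⟨?_, ?_, h.rank e he⟩
  · unfold nd
    rw [Finset.card_eq_sum_ones e]
    simp only [Finset.card_filter]
    rw [← Finset.sum_add_distrib, ← Finset.sum_add_distrib]
    apply Finset.sum_congr rfl
    intro v _
    rcases hr v with h | h | h <;> simp [h]
  · rw [← h.sum_edge he]
    unfold nd
    simp only [Finset.card_filter]
    rw [Finset.mul_sum, Finset.mul_sum, ← Finset.sum_add_distrib, ← Finset.sum_add_distrib]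
    congr 1
    apply Finset.sum_congr rfl
    intro v _
    rcases hr v with h | h | h <;> simp [h]

theorem Good.erase {E : Finset (Finset V)} (h : Good E) {f : Finset V}
    (hf1 : ∀ v ∈ f, degree E v ≠ 1) : Good (E.erase f) where
  lin e he g hg := h.lin e (Finset.mem_of_mem_erase he) g (Finset.mem_of_mem_erase hg)
  int e he g hg := h.int e (Finset.mem_of_mem_erase he) g (Finset.mem_of_mem_erase hg)
  rank e he := h.rank e (Finset.mem_of_mem_erase he)
  ni v := by
    obtain ⟨e, he, hv⟩ := h.ni v
    by_cases hef : e = f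
    · subst hef
      have := hf1 v hv
      have := h.deg_pos v
      obtain ⟨g, hg, hvg, hne⟩ := exists_other (E := E) (e := e) (v := v) (by omega)
      exact ⟨g, by simp [hg, hne], hvg⟩
    · exact ⟨e, by simp [he, hef], hv⟩
  K u v := by
    obtain ⟨w, hw⟩ := h.K u v
    exact ⟨w, fun e he => hw e (Finset.mem_of_mem_erase he)⟩

theorem Good.low0 {E : Finset (Finset V)} (h : Good E) (u : V) :
    ∃ w, degree E u + 2 + degree E w ≤ E.card := by
  obtain ⟨w, hw⟩ := h.K u u
  obtain ⟨g, hg, hwg⟩ := h.ni w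
  obtain ⟨w', hw'⟩ := h.K u w
  obtain ⟨g', hg', hwg'⟩ := h.ni w'
  obtain ⟨v, hv⟩ := h.int g hg g' hg'
  obtain ⟨x, hx⟩ := h.K u v
  refine ⟨x, ?_⟩
  have hne : g ≠ g' := by
    rintro rfl
    exact (hw' g hg hwg').2 hwg
  have h2 : ({g, g'} : Finset (Finset V)).card = 2 := Finset.card_pair hne
  have hug := (hw g hg hwg).1
  have hug' := (hw' g' hg' hwg').1
  have hd1 : Disjoint (E.filter (fun e => u ∈ e)) ({g, g'} : Finset (Finset V)) := by
    rw [Finset.disjoint_left]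
    intro a ha
    simp at ha ⊢
    constructor <;> (rintro rfl; tauto)
  have hd2 : Disjoint (E.filter (fun e => u ∈ e) ∪ ({g, g'} : Finset (Finset V)))
      (E.filter (fun e => x ∈ e)) := by
    rw [Finset.disjoint_right]
    intro a ha
    simp only [Finset.mem_filter] at ha
    have := hx a ha.1 ha.2
    simp only [Finset.mem_union, Finset.mem_filter, Finset.mem_insert, Finset.mem_singleton]
    rintro (h | rfl | rfl) <;> tauto
  have := Finset.card_union_of_disjoint hd2
  rw [Finset.card_union_of_disjoint hd1, h2] at this
  unfold degree
  rw [← this]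
  apply Finset.card_le_card
  intro a
  simp only [Finset.mem_union, Finset.mem_filter, Finset.mem_insert, Finset.mem_singleton]
  rintro ((h | rfl | rfl) | h) <;> tauto

theorem Good.low [Nonempty V] {E : Finset (Finset V)} (h : Good E) : 6 ≤ E.card := by
  by_contra hlt
  have hle : ∀ u, degree E u ≤ 2 := by
    intro u
    obtain ⟨w, hw⟩ := h.low0 u
    have := h.deg_pos w
    omega
  have h3 : ∀ e ∈ E, nd E 3 e = 0 := by
    intro e he
    unfold nd
    rw [Finset.card_eq_zero, Finset.filter_eq_empty_iff]
    intro v _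
    have := hle v
    omega
  obtain ⟨u⟩ := ‹Nonempty V›
  have hu := h.deg_pos u
  obtain ⟨w, hw⟩ := h.low0 u
  have hw' := h.deg_pos w
  -- some vertex has degree two
  have : ∃ x, degree E x = 2 := by
    by_contra hno
    push Not at hno
    obtain ⟨e, he, hu⟩ := h.ni u
    have h2 : nd E 2 e = 0 := by
      unfold nd
      rw [Finset.card_eq_zero, Finset.filter_eq_empty_iff]
      intro v _
      exact hno v
    have := h.counts he
    have := h3 e he
    omega
  obtain ⟨x, hx⟩ := this
  obtain ⟨y, hy⟩ := h.low0 x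
  have hy' := h.deg_pos y
  have hy1 : degree E y = 1 := by omega
  obtain ⟨e, he, hye⟩ := h.ni y
  have h1 : 1 ≤ nd E 1 e := Finset.card_pos.2 ⟨y, by simp [hye, hy1]⟩
  have := h.counts he
  have := h3 e he
  omega

theorem nd_pos {E : Finset (Finset V)} {k : ℕ} {e : Finset V} :
    1 ≤ nd E k e ↔ ∃ v ∈ e, degree E v = k := by
  unfold nd
  rw [Nat.succ_le_iff, Finset.card_pos]
  simp [Finset.Nonempty]

theorem Good.six_nd [Nonempty V] {E : Finset (Finset V)} (h : Good E) (hc : E.card = 6)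
    {e : Finset V} (he : e ∈ E) : nd E 1 e = 1 ∧ nd E 2 e = 1 ∧ nd E 3 e = 2 ∧ e.card = 4 := by
  have h1 : 1 ≤ nd E 1 e := by
    rw [nd_pos]
    by_contra hno
    push Not at hno
    have := (h.erase hno).low
    rw [Finset.card_erase_of_mem he] at this
    omega
  have := h.counts he
  omega

theorem Good.not_eight [Nonempty V] {E : Finset (Finset V)} (h : Good E) (hc : E.card = 8) :
    False := by
  have hall : ∀ e ∈ E, nd E 1 e = 0 ∧ nd E 2 e = 1 := by
    intro e he
    have := h.counts he
    omega
  have hd1 : ∀ v, degree E v ≠ 1 := by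
    intro v hv
    obtain ⟨e, he, hve⟩ := h.ni v
    have := (nd_pos (E := E) (k := 1) (e := e)).2 ⟨v, hve, hv⟩
    have := (hall e he).1
    omega
  have huniq : ∀ e ∈ E, ∀ x ∈ e, ∀ y ∈ e, degree E x = 2 → degree E y = 2 → x = y := by
    intro e he x hx y hy hx2 hy2
    exact Finset.card_le_one.1 (le_of_eq (hall e he).2) x (by simp [hx, hx2]) y (by simp [hy, hy2])
  obtain ⟨f, hf⟩ : E.Nonempty := Finset.card_pos.1 (by omega)
  have h7 := h.erase (f := f) (fun v _ => hd1 v)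
  have hc7 : (E.erase f).card = 7 := by rw [Finset.card_erase_of_mem hf, hc]
  have : ∃ g ∈ E.erase f, ∀ v ∈ g, degree (E.erase f) v ≠ 1 := by
    by_contra hno
    push Not at hno
    choose! z hz1 hz2 using hno
    have hz : ∀ g ∈ E.erase f, z g ∈ f ∧ degree E (z g) = 2 := by
      intro g hg
      have h1 := degree_erase E hf (z g)
      have h2 := hd1 (z g)
      rw [hz2 g hg] at h1
      split_ifs at h1 with hh
      · exact ⟨hh, h1⟩
      · exact absurd h1 h2
    obtain ⟨g₀, hg₀⟩ : (E.erase f).Nonempty := Finset.card_pos.1 (by omega)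
    have : E.erase f ⊆ (E.erase f).filter (fun e => z g₀ ∈ e) := by
      intro g hg
      have : z g₀ = z g := huniq f hf _ (hz g₀ hg₀).1 _ (hz g hg).1 (hz g₀ hg₀).2 (hz g hg).2
      rw [Finset.mem_filter]
      exact ⟨hg, this ▸ hz1 g hg⟩
    have := Finset.card_le_card this
    have h2 := hz2 g₀ hg₀
    unfold degree at h2
    omega
  obtain ⟨g, hg, hg1⟩ := this
  have hgE := Finset.mem_of_mem_erase hg
  have h6 := h7.erase hg1
  have hc6 : ((E.erase f).erase g).card = 6 := by rw [Finset.card_erase_of_mem hg, hc7]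
  have hz : ∀ e ∈ (E.erase f).erase g, ∃ v ∈ e, degree ((E.erase f).erase g) v = 1 := by
    intro e he
    rw [← nd_pos]
    exact le_of_eq (h6.six_nd hc6 he).1.symm
  choose! z hz1 hz2 using hz
  have hle : ((E.erase f).erase g).card ≤
      (f ∩ g ∪ (f.filter (fun v => degree E v = 2) ∪ g.filter (fun v => degree E v = 2))).card := by
    apply Finset.card_le_card_of_injOn z
    · intro e he
      have a1 := degree_erase E hf (z e)
      have a2 := degree_erase (E.erase f) hg (z e)
      have a3 := hz2 e he
      have a4 := hd1 (z e)
      simp only [Finset.coe_union, Set.mem_union, Finset.mem_coe, Finset.mem_inter,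
        Finset.mem_filter]
      by_cases b1 : z e ∈ f <;> by_cases b2 : z e ∈ g <;> simp only [b1, b2, if_true, if_false] at a1 a2 <;>
        simp only [b1, b2, true_and, false_and, true_or, false_or, or_false, and_false] <;> omega
    · intro e he e' he' hee
      exact deg_one_unique (hz2 e he) he he' (hz1 e he) (by rw [hee]; exact hz1 e' he')
  have i1 : (f ∩ g).card ≤ 1 := by
    rw [Finset.card_le_one]
    intro a ha b hb
    simp at ha hb hg
    by_contra hne
    exact hg.1 (h.lin g hg.2 f hf a b ha.2 hb.2 ha.1 hb.1 hne)
  have i2 := (hall f hf).2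
  have i3 := (hall g hgE).2
  unfold nd at i2 i3
  have j1 := Finset.card_union_le (f ∩ g)
    (f.filter (fun v => degree E v = 2) ∪ g.filter (fun v => degree E v = 2))
  have j2 := Finset.card_union_le (f.filter (fun v => degree E v = 2))
    (g.filter (fun v => degree E v = 2))
  omega

theorem Good.six_or_seven [Nonempty V] {E : Finset (Finset V)} (h : Good E) :
    E.card = 6 ∨ E.card = 7 := by
  have hlow := h.low
  obtain ⟨f, hf⟩ : E.Nonempty := Finset.card_pos.1 (by omega)
  have hcf := h.counts hf
  have h8 := h.not_eight
  have h9 : E.card ≠ 9 := by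
    intro h9
    have : Good (E.erase f) := by
      apply h.erase
      intro v hv hv1
      have := (nd_pos (E := E) (k := 1) (e := f)).2 ⟨v, hv, hv1⟩
      omega
    exact this.not_eight (by rw [Finset.card_erase_of_mem hf, h9])
  by_contra hno
  have : E.card ≠ 8 := h8
  omega

/-- Seven triples in a seven-set pairwise meeting in at most one point form a Fano plane. -/
theorem fano_of {S : Finset V} {L : Finset (Finset V)} (hS : S.card = 7) (hL : L.card = 7)
    (h3 : ∀ e ∈ L, e ⊆ S ∧ e.card = 3)
    (hl : ∀ e ∈ L, ∀ f ∈ L, ∀ u v : V, u ∈ e → v ∈ e → u ∈ f → v ∈ f → u ≠ v → e = f) :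
    isFano S L := by
  refine ⟨hS, hL, h3, ?_⟩
  have hcov : L.biUnion (fun e => e.powersetCard 2) = S.powersetCard 2 := by
    apply Finset.eq_of_subset_of_card_le
    · intro a ha
      simp only [Finset.mem_biUnion, Finset.mem_powersetCard] at ha ⊢
      obtain ⟨e, he, hae, hac⟩ := ha
      exact ⟨hae.trans (h3 e he).1, hac⟩
    · rw [Finset.card_biUnion]
      · rw [Finset.sum_congr rfl (g := fun _ => 3)]
        · simp [hS, hL]
          decide
        · intro e he
          rw [Finset.card_powersetCard, (h3 e he).2]
          decide
      · intro e he f hf hne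
        change Disjoint (e.powersetCard 2) (f.powersetCard 2)
        rw [Finset.disjoint_left]
        intro a ha hb
        simp only [Finset.mem_powersetCard] at ha hb
        obtain ⟨x, y, hxy, rfl⟩ := Finset.card_eq_two.1 ha.2
        apply hne
        have h1 := ha.1
        have h2 := hb.1
        exact hl e he f hf x y (h1 (by simp)) (h1 (by simp)) (h2 (by simp)) (h2 (by simp)) hxy
  intro u hu v hv huv
  have : ({u, v} : Finset V) ∈ S.powersetCard 2 := by
    rw [Finset.mem_powersetCard]
    refine ⟨?_, Finset.card_pair huv⟩
    intro x
    simp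
    rintro (rfl | rfl) <;> assumption
  rw [← hcov] at this
  simp only [Finset.mem_biUnion, Finset.mem_powersetCard] at this
  obtain ⟨e, he, hs, _⟩ := this
  have hue : u ∈ e := hs (by simp)
  have hve : v ∈ e := hs (by simp)
  refine ⟨e, ⟨he, hue, hve⟩, ?_⟩
  rintro f ⟨hf, huf, hvf⟩
  exact hl f hf e he u v huf hvf hue hve huv

theorem Good.trace [Nonempty V] {E : Finset (Finset V)} (h : Good E) (S : Finset V)
    (h3 : ∀ e ∈ E, (e ∩ S).card = 3) (h4 : ∀ e ∈ E, e.card = 4)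
    (h1 : ∀ v, v ∉ S → degree E v = 1) :
    ∃ (L : Finset (Finset V)) (p : Finset V → V), L = E.image (fun e => e ∩ S) ∧
      L.card = E.card ∧ (∀ l ∈ L, p l ∉ S) ∧ Set.InjOn p (L : Set (Finset V)) ∧
      (∀ w : V, w ∈ S ∨ ∃ l ∈ L, p l = w) ∧ E = L.image (fun l => insert (p l) l) ∧
      (∀ e ∈ L, ∀ f ∈ L, ∀ u v : V, u ∈ e → v ∈ e → u ∈ f → v ∈ f → u ≠ v → e = f) := by
  have hlin : ∀ e ∈ E, ∀ f ∈ E, e ∩ S ⊆ f → e = f := by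
    intro e he f hf hs
    obtain ⟨a, ha, b, hb, hab⟩ := Finset.one_lt_card.1 (show 1 < (e ∩ S).card by rw [h3 e he]; omega)
    have ha' := hs ha
    have hb' := hs hb
    simp only [Finset.mem_inter] at ha hb
    exact h.lin e he f hf a b ha.1 hb.1 ha' hb' hab
  have hp : ∀ l ∈ E.image (fun e => e ∩ S), ∃ w, w ∉ S ∧ insert w l ∈ E := by
    intro l hl
    simp only [Finset.mem_image] at hl
    obtain ⟨e, he, rfl⟩ := hl
    have hcard : (e \ S).card = 1 := by
      have := Finset.card_sdiff_add_card_inter e S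
      have := h3 e he
      have := h4 e he
      omega
    obtain ⟨w, hw⟩ := Finset.card_eq_one.1 hcard
    have hww : w ∈ e \ S := by rw [hw]; simp
    refine ⟨w, (Finset.mem_sdiff.1 hww).2, ?_⟩
    have : insert w (e ∩ S) = e := by
      rw [Finset.insert_eq, ← hw, Finset.sdiff_union_inter]
    rw [this]
    exact he
  choose! p hp1 hp2 using hp
  have hpe : ∀ e ∈ E, insert (p (e ∩ S)) (e ∩ S) = e := by
    intro e he
    symm
    apply hlin e he _ (hp2 _ (Finset.mem_image_of_mem _ he))
    exact Finset.subset_insert _ _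
  refine ⟨E.image (fun e => e ∩ S), p, rfl, ?_, hp1, ?_, ?_, ?_, ?_⟩
  · apply Finset.card_image_of_injOn
    intro e he f hf hef
    apply hlin e he f hf
    change e ∩ S = f ∩ S at hef
    rw [hef]
    exact Finset.inter_subset_left
  · intro l hl l' hl' hll
    have hl0 := hl
    have hl0' := hl'
    simp only [Finset.coe_image, Set.mem_image, Finset.mem_coe] at hl hl'
    obtain ⟨e, he, rfl⟩ := hl
    obtain ⟨f, hf, rfl⟩ := hl'
    have : e = f := by
      apply deg_one_unique (h1 _ (hp1 _ hl0)) he hf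
      · exact (hpe e he).subset (Finset.mem_insert_self (p (e ∩ S)) (e ∩ S))
      · rw [hll]
        exact (hpe f hf).subset (Finset.mem_insert_self (p (f ∩ S)) (f ∩ S))
    rw [this]
  · intro w
    by_cases hw : w ∈ S
    · exact Or.inl hw
    · right
      obtain ⟨e, he, hwe⟩ := h.ni w
      refine ⟨e ∩ S, Finset.mem_image_of_mem _ he, ?_⟩
      rw [← hpe e he] at hwe
      simp only [Finset.mem_insert, Finset.mem_inter] at hwe
      tauto
  · rw [Finset.image_image]
    ext e
    simp only [Finset.mem_image, Function.comp]
    constructor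
    · intro he
      exact ⟨e, he, hpe e he⟩
    · rintro ⟨f, hf, rfl⟩
      rw [hpe f hf]
      exact hf
  · intro l hl l' hl' u v
    simp only [Finset.mem_image] at hl hl'
    obtain ⟨e, he, rfl⟩ := hl
    obtain ⟨f, hf, rfl⟩ := hl'
    simp only [Finset.mem_inter]
    intro a b c d hne
    rw [h.lin e he f hf u v a.1 b.1 c.1 d.1 hne]

theorem count_deg (E : Finset (Finset V)) (k : ℕ) :
    (Finset.univ.filter (fun v => degree E v = k)).card * k = ∑ e ∈ E, nd E k e := by
  have := sum_deg E (Finset.univ.filter (fun v => degree E v = k))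
  rw [Finset.sum_congr rfl (g := fun _ => k) (by intro v hv; simpa using hv)] at this
  rw [Finset.sum_const, smul_eq_mul] at this
  rw [this]
  apply Finset.sum_congr rfl
  intro e _
  unfold nd
  congr 1
  ext v
  simp [and_comm]

/-- The structure of the six-edge hypergraph. -/
theorem Good.six [Nonempty V] {E : Finset (Finset V)} (h : Good E) (hc : E.card = 6) :
    ∃ (S : Finset V) (F : Finset (Finset V)) (e₀ : Finset V) (p : Finset V → V),
      e₀ = Finset.univ.filter (fun v => degree E v = 2) ∧ e₀.card = 3 ∧
      isFano S F ∧ e₀ ∈ F ∧ (∀ e ∈ F.erase e₀, p e ∉ S) ∧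
      Set.InjOn p ((F.erase e₀ : Finset (Finset V)) : Set (Finset V)) ∧
      (∀ w : V, w ∈ S ∨ ∃ e ∈ F.erase e₀, p e = w) ∧
      E = (F.erase e₀).image (fun e => insert (p e) e) := by
  have hnd := fun e (he : e ∈ E) => h.six_nd hc he
  have c2 := count_deg E 2
  have c3 := count_deg E 3
  rw [Finset.sum_congr rfl (fun e he => (hnd e he).2.1)] at c2
  rw [Finset.sum_congr rfl (fun e he => (hnd e he).2.2.1)] at c3
  simp only [Finset.sum_const, hc, smul_eq_mul] at c2 c3
  set e₀ := Finset.univ.filter (fun v => degree E v = 2) with he₀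
  set s₃ := Finset.univ.filter (fun v => degree E v = 3) with hs₃
  have hinter2 : ∀ e ∈ E, (e ∩ e₀).card = 1 := by
    intro e he
    rw [← (hnd e he).2.1]
    unfold nd
    congr 1
    ext v
    simp [he₀]
  have hinter3 : ∀ e ∈ E, (e ∩ s₃).card = 2 := by
    intro e he
    rw [← (hnd e he).2.2.1]
    unfold nd
    congr 1
    ext v
    simp [hs₃]
  have hdisj : Disjoint e₀ s₃ := by
    rw [Finset.disjoint_left]
    intro v
    simp [he₀, hs₃]
    omega
  have h3 : ∀ e ∈ E, (e ∩ (e₀ ∪ s₃)).card = 3 := by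
    intro e he
    rw [Finset.inter_union_distrib_left, Finset.card_union_of_disjoint, hinter2 e he, hinter3 e he]
    exact hdisj.mono Finset.inter_subset_right Finset.inter_subset_right
  have h1 : ∀ v, v ∉ e₀ ∪ s₃ → degree E v = 1 := by
    intro v hv
    have := h.deg_pos v
    have := h.deg_le v
    simp [he₀, hs₃] at hv
    omega
  obtain ⟨L, p, hL, hLc, p1, p2, p3, p4, p5⟩ :=
    h.trace (e₀ ∪ s₃) h3 (fun e he => (hnd e he).2.2.2) h1
  have hLe : ∀ l ∈ L, ∃ e ∈ E, e ∩ (e₀ ∪ s₃) = l := by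
    intro l hl
    rw [hL] at hl
    simpa using hl
  have hLsmall : ∀ l ∈ L, ∀ u v : V, u ∈ e₀ → v ∈ e₀ → u ∈ l → v ∈ l → u = v := by
    intro l hl u v hu hv hul hvl
    obtain ⟨e, he, rfl⟩ := hLe l hl
    rw [Finset.mem_inter] at hul hvl
    exact Finset.card_le_one.1 (le_of_eq (hinter2 e he)) u (by simp [hul.1, hu]) v
      (by simp [hvl.1, hv])
  have he₀c : e₀.card = 3 := by omega
  have hnot : e₀ ∉ L := by
    intro hmem
    obtain ⟨a, ha, b, hb, hab⟩ := Finset.one_lt_card.1 (show 1 < e₀.card by omega)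
    exact hab (hLsmall e₀ hmem a b ha hb ha hb)
  have her : (insert e₀ L).erase e₀ = L := Finset.erase_insert hnot
  refine ⟨e₀ ∪ s₃, insert e₀ L, e₀, p, rfl, he₀c, ?_, by simp, ?_, ?_, ?_, ?_⟩
  · apply fano_of
    · rw [Finset.card_union_of_disjoint hdisj]
      omega
    · rw [Finset.card_insert_of_notMem hnot]
      omega
    · intro l hl
      rw [Finset.mem_insert] at hl
      rcases hl with rfl | hl
      · exact ⟨Finset.subset_union_left, he₀c⟩
      · obtain ⟨e, he, rfl⟩ := hLe l hl
        exact ⟨Finset.inter_subset_right, h3 e he⟩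
    · intro l hl l' hl' u v a b c d hne
      rw [Finset.mem_insert] at hl hl'
      rcases hl with rfl | hl <;> rcases hl' with rfl | hl'
      · rfl
      · exact absurd (hLsmall l' hl' u v a b c d) hne
      · exact absurd (hLsmall l hl u v c d a b) hne
      · exact p5 l hl l' hl' u v a b c d hne
  all_goals rw [her]; assumption

/-- The case of seven edges each having a private vertex. -/
theorem Good.sevenF1 [Nonempty V] {E : Finset (Finset V)} (h : Good E) (hc : E.card = 7)
    (hp : ∀ e ∈ E, 1 ≤ nd E 1 e) : isF1 E := by
  have hnd : ∀ e ∈ E, nd E 1 e = 1 ∧ nd E 2 e = 0 ∧ nd E 3 e = 3 ∧ e.card = 4 := by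
    intro e he
    have := h.counts he
    have := hp e he
    omega
  have c3 := count_deg E 3
  rw [Finset.sum_congr rfl (fun e he => (hnd e he).2.2.1)] at c3
  simp only [Finset.sum_const, hc, smul_eq_mul] at c3
  set s₃ := Finset.univ.filter (fun v => degree E v = 3) with hs₃
  have h3 : ∀ e ∈ E, (e ∩ s₃).card = 3 := by
    intro e he
    rw [← (hnd e he).2.2.1]
    unfold nd
    congr 1
    ext v
    simp [hs₃]
  have h1 : ∀ v, v ∉ s₃ → degree E v = 1 := by
    intro v hv
    have := h.deg_pos v
    have := h.deg_le v
    simp [hs₃] at hv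
    obtain ⟨e, he, hve⟩ := h.ni v
    have h2 : degree E v ≠ 2 := by
      intro h2
      have := (nd_pos (E := E) (k := 2) (e := e)).2 ⟨v, hve, h2⟩
      have := (hnd e he).2.1
      omega
    omega
  obtain ⟨L, p, hL, hLc, p1, p2, p3, p4, p5⟩ :=
    h.trace s₃ h3 (fun e he => (hnd e he).2.2.2) h1
  refine ⟨s₃, L, p, ?_, p1, p2, p3, p4⟩
  apply fano_of (by omega) (by omega) _ p5
  intro l hl
  rw [hL] at hl
  simp only [Finset.mem_image] at hl
  obtain ⟨e, he, rfl⟩ := hl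
  exact ⟨Finset.inter_subset_right, h3 e he⟩

theorem Good.main [Nonempty V] {E : Finset (Finset V)} (h : Good E) :
    isF1 E ∨ isF1minus E ∨ isF2 E ∨ isF3 E := by
  rcases h.six_or_seven with hc | hc
  · right; left
    obtain ⟨S, F, e₀, p, -, -, h1, h2, h3, h4, h5, h6⟩ := h.six hc
    exact ⟨S, F, e₀, p, h1, h2, h3, h4, h5, h6⟩
  · by_cases hp : ∀ e ∈ E, 1 ≤ nd E 1 e
    · exact Or.inl (h.sevenF1 hc hp)
    · right; right
      push Not at hp
      obtain ⟨f, hf, hf1⟩ := hp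
      have hd1 : ∀ v ∈ f, degree E v ≠ 1 := by
        intro v hv hv1
        have := (nd_pos (E := E) (k := 1) (e := f)).2 ⟨v, hv, hv1⟩
        omega
      have h6 := h.erase hd1
      have hc6 : (E.erase f).card = 6 := by rw [Finset.card_erase_of_mem hf, hc]
      have hins := Finset.insert_erase hf
      obtain ⟨S, F, e₀, p, he₀, he₀c, q1, q2, q3, q4, q5, q6⟩ := h6.six hc6
      have hdeg : ∀ v ∈ f, degree E v = degree (E.erase f) v + 1 := by
        intro v hv
        have := degree_erase E hf v
        rwa [if_pos hv] at this
      have hcf := h.counts hf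
      have hcase : (nd E 3 f = 3 ∧ f.card = 3) ∨ (nd E 3 f = 2 ∧ nd E 2 f = 2 ∧ f.card = 4) := by
        omega
      rcases hcase with ⟨hn3, hf3⟩ | ⟨hn3, hn2, hf4⟩
      · left
        have hfe : f = e₀ := by
          apply Finset.eq_of_subset_of_card_le _ (by omega)
          have : f.filter (fun v => degree E v = 3) = f :=
            Finset.eq_of_subset_of_card_le (Finset.filter_subset _ _)
              (by unfold nd at hn3; omega)
          intro v hv
          rw [← this, Finset.mem_filter] at hv
          have := hdeg v hv.1
          rw [he₀]
          simp
          omega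
        refine ⟨S, F, e₀, p, q1, q2, q3, q4, q5, ?_⟩
        rw [← q6, ← hfe, hins]
      · right
        obtain ⟨x₁, x₂, h12, hx12⟩ := Finset.card_eq_two.1 hn3
        obtain ⟨x₃, x₄, h34, hx34⟩ := Finset.card_eq_two.1 hn2
        have m1 : x₁ ∈ f ∧ degree E x₁ = 3 := by
          rw [← Finset.mem_filter (p := fun v => degree E v = 3), hx12]; simp
        have m2 : x₂ ∈ f ∧ degree E x₂ = 3 := by
          rw [← Finset.mem_filter (p := fun v => degree E v = 3), hx12]; simp
        have m3 : x₃ ∈ f ∧ degree E x₃ = 2 := by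
          rw [← Finset.mem_filter (p := fun v => degree E v = 2), hx34]; simp
        have m4 : x₄ ∈ f ∧ degree E x₄ = 2 := by
          rw [← Finset.mem_filter (p := fun v => degree E v = 2), hx34]; simp
        have h13 : x₁ ≠ x₃ := by rintro rfl; omega
        have h14 : x₁ ≠ x₄ := by rintro rfl; omega
        have h23 : x₂ ≠ x₃ := by rintro rfl; omega
        have h24 : x₂ ≠ x₄ := by rintro rfl; omega
        have hX : ({x₁, x₂, x₃, x₄} : Finset V).card = 4 := by
          simp [h12, h13, h14, h23, h24, h34]
        have hXf : ({x₁, x₂, x₃, x₄} : Finset V) = f := by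
          apply Finset.eq_of_subset_of_card_le _ (by omega)
          intro v
          simp only [Finset.mem_insert, Finset.mem_singleton]
          rintro (rfl | rfl | rfl | rfl)
          exacts [m1.1, m2.1, m3.1, m4.1]
        obtain ⟨e₁, a1, b1⟩ := h6.ni x₁
        obtain ⟨e₂, a2, b2⟩ := h6.ni x₂
        obtain ⟨e₃, a3, b3⟩ := h6.ni x₃
        obtain ⟨e₄, a4, b4⟩ := h6.ni x₄
        have hne : ∀ e ∈ E.erase f, ∀ e' ∈ E.erase f, ∀ x y : V, x ∈ f → y ∈ f → x ∈ e → y ∈ e' →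
            x ≠ y → e ≠ e' := by
          rintro e he e' he' x y hx hy hxe hye hxy rfl
          rw [Finset.mem_erase] at he
          exact he.1 (h.lin e he.2 f hf x y hxe hye hx hy hxy)
        refine ⟨E.erase f, x₁, x₂, x₃, x₄, e₁, e₂, e₃, e₄,
          ⟨S, F, e₀, p, q1, q2, q3, q4, q5, q6⟩, hX, a1, a2, a3, a4,
          hne _ a1 _ a2 _ _ m1.1 m2.1 b1 b2 h12, hne _ a1 _ a3 _ _ m1.1 m3.1 b1 b3 h13,
          hne _ a1 _ a4 _ _ m1.1 m4.1 b1 b4 h14, hne _ a2 _ a3 _ _ m2.1 m3.1 b2 b3 h23,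
          hne _ a2 _ a4 _ _ m2.1 m4.1 b2 b4 h24, hne _ a3 _ a4 _ _ m3.1 m4.1 b3 b4 h34,
          b1, b2, b3, b4, ?_, ?_, ?_, ?_, ?_⟩
        · have := hdeg x₁ m1.1; omega
        · have := hdeg x₂ m2.1; omega
        · have := hdeg x₃ m3.1; omega
        · have := hdeg x₄ m4.1; omega
        · rw [hXf, hins]

theorem stmt_18 (E : Finset (Finset V))
    (hlin : Linear E) (hint : Intersecting E)
    (hrank : ∀ e ∈ E, 2 ≤ e.card ∧ e.card ≤ 4)
    (hni : NoIsolated E)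
    (hdom : domNum E = 3) :
    isF1 E ∨ isF1minus E ∨ isF2 E ∨ isF3 E := by
  have hmin : ∀ D : Finset V, isDominating E D → 3 ≤ D.card := by
    intro D hD
    rw [← hdom]
    exact Nat.sInf_le ⟨D, hD, rfl⟩
  have hV : Nonempty V := by
    by_contra hV
    rw [not_nonempty_iff] at hV
    have := hmin ∅ (fun v => hV.elim v)
    simp at this
  have hgood : Good E := by
    refine ⟨?_, ?_, fun e he => (hrank e he).2, hni, ?_⟩
    · intro e he f hf u v a b c d hne
      by_contra hef
      exact hne (Finset.card_le_one.1 (hlin e he f hf hef) u (by simp [a, c]) v (by simp [b, d]))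
    · intro e he f hf
      obtain ⟨v, hv⟩ := hint e he f hf
      exact ⟨v, Finset.mem_inter.1 hv⟩
    · intro u v
      by_contra hno
      push Not at hno
      have := hmin {u, v} (by
        intro w _
        obtain ⟨e, he, hwe, huv⟩ := hno w
        refine ⟨e, he, hwe, ?_⟩
        by_cases hu : u ∈ e
        · exact ⟨u, hu, by simp⟩
        · exact ⟨v, huv hu, by simp⟩)
      have := Finset.card_le_two (a := u) (b := v)
      omega
  exact hgood.main
end
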